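/- Let B be the ℂ-subalgebra of ℂ[x_1, …, x_{N+1}, p_1, …, p_{N+1}] generated by the classical angular momenta M_{ij}, 1 ≤ i < j ≤ N+1, and let I be the ideal of B generated by M²_{(N+1)} = Σ_{1≤i<j≤N+1} M_{ij}². Then a ℂ-linear basis of the quotient B/I is given by the coset classes of the distinct monomials M_{i₁j₁}^{n₁} ⋯ M_{i_k j_k}^{n_k} (pairwise distinct pairs (i_s, j_s) with i_s < j_s ≤ N+1, exponents n_s ≥ 1, together with 1) that have no crossings and in which M_{N,N+1} occurs with exponent at most 1. -/

import Mathlib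

/-!
STATEMENT 15: a linear basis of the central quotient `B/I`, where `B` is the algebra
generated by the classical angular momenta `M_{ij}`, `1 ≤ i < j ≤ N+1`, and `I` is the
ideal of `B` generated by `M²_{(N+1)} = Σ_{i<j} M_{ij}²`, is given by the cosets of the
distinct no-crossing monomials in which `M_{N,N+1}` occurs with exponent at most 1.
-/

noncomputable section

open Finset MvPolynomial

/-- The polynomial ring `ℂ[x_1, …, x_{N+1}, p_1, …, p_{N+1}]`. -/
abbrev PR (N : ℕ) := MvPolynomial (Fin (N + 1) ⊕ Fin (N + 1)) ℂ

/-- The classical angular momentum `M_{ij} = x_i p_j − x_j p_i`. -/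
def Mang {N : ℕ} (i j : Fin (N + 1)) : PR N :=
  X (Sum.inl i) * X (Sum.inr j) - X (Sum.inl j) * X (Sum.inr i)

/-- The subalgebra `B` generated by the classical angular momenta. -/
def Balg (N : ℕ) : Subalgebra ℂ (PR N) :=
  Algebra.adjoin ℂ { q : PR N | ∃ i j : Fin (N + 1), i < j ∧ q = Mang i j }

/-- `M²_{(N+1)} = Σ_{i<j} M_{ij}²`. -/
def Msq (N : ℕ) : PR N := ∑ i, ∑ j, if i < j then Mang i j ^ 2 else 0

lemma Msq_mem (N : ℕ) : Msq N ∈ Balg N := by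
  refine Subalgebra.sum_mem _ fun i _ => Subalgebra.sum_mem _ fun j _ => ?_
  by_cases h : i < j
  · rw [if_pos h]
    have hm : Mang i j ∈ { q : PR N | ∃ i j : Fin (N + 1), i < j ∧ q = Mang i j } :=
      ⟨i, j, h, rfl⟩
    exact Subalgebra.pow_mem _ (Algebra.subset_adjoin hm) 2
  · rw [if_neg h]
    exact Subalgebra.zero_mem _

/-- The ideal `I` of `B` generated by `M²_{(N+1)}`. -/
def Iid (N : ℕ) : Ideal (Balg N) := Ideal.span {(⟨Msq N, Msq_mem N⟩ : Balg N)}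

/-- The monomial `∏_{i<j} M_{ij}^{n_{ij}}`, as an element of `B`. -/
def monB (N : ℕ) (n : Fin (N + 1) → Fin (N + 1) → ℕ) : Balg N :=
  ⟨∏ i, ∏ j, if i < j then Mang i j ^ n i j else 1, by
    refine Subalgebra.prod_mem _ fun i _ => Subalgebra.prod_mem _ fun j _ => ?_
    by_cases h : i < j
    · rw [if_pos h]
      have hm : Mang i j ∈ { q : PR N | ∃ i j : Fin (N + 1), i < j ∧ q = Mang i j } :=
        ⟨i, j, h, rfl⟩
      exact Subalgebra.pow_mem _ (Algebra.subset_adjoin hm) (n i j)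
    · rw [if_neg h]
      exact Subalgebra.one_mem _⟩

/-- The arcs of the monomial with exponents `n`. -/
def ArcM {N : ℕ} (n : Fin (N + 1) → Fin (N + 1) → ℕ) (p : ℕ × ℕ) : Prop :=
  ∃ i j : Fin (N + 1), i < j ∧ n i j ≠ 0 ∧ p = ((i : ℕ), (j : ℕ))

/-- The monomial with exponents `n` has no crossings. -/
def NoCrossM {N : ℕ} (n : Fin (N + 1) → Fin (N + 1) → ℕ) : Prop :=
  ∀ p q : ℕ × ℕ, ArcM n p → ArcM n q → ¬(p.1 < q.1 ∧ q.1 < p.2 ∧ p.2 < q.2)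

/-- Admissible exponent data: supported on `i < j`, no crossings, and the exponent of
`M_{N,N+1}` (the pair of the last two indices) is at most 1. -/
def GoodM (N : ℕ) (n : Fin (N + 1) → Fin (N + 1) → ℕ) : Prop :=
  (∀ i j : Fin (N + 1), ¬ i < j → n i j = 0) ∧ NoCrossM n ∧
    (∀ i j : Fin (N + 1), (i : ℕ) = N - 1 → (j : ℕ) = N → n i j ≤ 1)

/-! ### Abstract unitriangularity lemma -/

theorem abs_quot {K V W ι γ : Type*} [Field K] [AddCommGroup V] [Module K V]
    [AddCommGroup W] [Module K W] (b : Module.Basis ι K V) (wt : ι → ℕ) (τ : ι → ι)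
    (hτ : Function.Injective τ) (hwt : ∀ i j, wt i ≤ wt j → wt (τ i) ≤ wt (τ j))
    (T : V →ₗ[K] V)
    (hT : ∀ i, T (b i) - b (τ i) ∈ Submodule.span K (b '' {j | wt j < wt (τ i)}))
    (g : γ → ι) (hg : Function.Injective g) (hgr : ∀ i, i ∈ Set.range g ↔ i ∉ Set.range τ)
    (q : V →ₗ[K] W) (hq : Function.Surjective q) (hk : LinearMap.ker q = LinearMap.range T) :
    LinearIndependent K (fun c => q (b (g c))) ∧
      Submodule.span K (Set.range (fun c => q (b (g c)))) = ⊤ := by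
  have hlow : ∀ i k, wt (τ i) ≤ wt k → b.repr (T (b i) - b (τ i)) k = 0 := by
    intro i k h
    have h1 := hT i
    rw [Module.Basis.mem_span_image] at h1
    by_contra hne
    have := h1 (Finsupp.mem_support_iff.2 hne)
    simp only [Set.mem_ofPred_eq] at this
    omega
  constructor
  · rw [linearIndependent_iff]
    intro l hl
    have hbg : LinearIndependent K (fun c => b (g c)) := b.linearIndependent.comp g hg
    rw [linearIndependent_iff] at hbg
    apply hbg
    have hl' : q (Finsupp.linearCombination K (fun c => b (g c)) l) = 0 := by
      rw [Finsupp.apply_linearCombination]; exact hl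
    have hm : Finsupp.linearCombination K (fun c => b (g c)) l ∈ LinearMap.range T := by
      rw [← hk]; exact hl'
    obtain ⟨y, hy⟩ := hm
    have hy0 : y = 0 := by
      by_contra hne
      have hs : (b.repr y).support.Nonempty := by
        rw [Finsupp.support_nonempty_iff]
        simpa using hne
      obtain ⟨k, hk1, hk2⟩ := Finset.exists_max_image _ wt hs
      have e1 : b.repr (Finsupp.linearCombination K (fun c => b (g c)) l) (τ k) = 0 := by
        rw [Finsupp.linearCombination_apply, Finsupp.sum, map_sum, Finsupp.finsetSum_apply]
        refine Finset.sum_eq_zero fun c _ => ?_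
        have : g c ≠ τ k := fun h => ((hgr (g c)).1 ⟨c, rfl⟩) ⟨k, h.symm⟩
        simp [Finsupp.single_apply, this]
      rw [← hy] at e1
      have e2 : b.repr (T y) (τ k) = b.repr y k := by
        conv_lhs => rw [← b.linearCombination_repr y]
        rw [Finsupp.linearCombination_apply, Finsupp.sum, map_sum, map_sum,
          Finsupp.finsetSum_apply]
        rw [Finset.sum_eq_single k]
        · have := hlow k (τ k) le_rfl
          rw [map_sub, Finsupp.sub_apply, sub_eq_zero] at this
          simp [this]
        · intro i hi hik
          have := hlow i (τ k) (hwt _ _ (hk2 i hi))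
          rw [map_sub, Finsupp.sub_apply, sub_eq_zero] at this
          have h3 : τ i ≠ τ k := fun h => hik (hτ h)
          simp [this, Finsupp.single_apply, h3]
        · intro h; exact absurd hk1 h
      rw [e2] at e1
      exact Finsupp.mem_support_iff.1 hk1 e1
    rw [← hy, hy0, map_zero]
  · set S := Submodule.span K (Set.range (fun c => q (b (g c)))) with hS
    have key : ∀ w i, wt i = w → q (b i) ∈ S := by
      intro w
      induction w using Nat.strong_induction_on with
      | _ w ih =>
        intro i hi
        by_cases h : i ∈ Set.range τ
        · obtain ⟨j, rfl⟩ := h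
          have h1 : q (T (b j)) = 0 := by
            have : T (b j) ∈ LinearMap.ker q := by rw [hk]; exact ⟨_, rfl⟩
            exact this
          have h2 : q (T (b j) - b (τ j)) ∈ S := by
            have h3 : Submodule.span K (b '' {k | wt k < wt (τ j)}) ≤ S.comap q := by
              rw [Submodule.span_le]
              rintro _ ⟨k, hk', rfl⟩
              exact ih (wt k) (by rw [← hi]; exact hk') k rfl
            exact h3 (hT j)
          rw [map_sub, h1, zero_sub] at h2
          simpa using S.neg_mem h2
        · obtain ⟨c, rfl⟩ := (hgr i).2 h
          exact Submodule.subset_span ⟨c, rfl⟩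
    have h4 : (⊤ : Submodule K V) ≤ S.comap q := by
      rw [← b.span_eq, Submodule.span_le]
      rintro _ ⟨i, rfl⟩
      exact key _ i rfl
    rw [eq_top_iff]
    intro w _
    obtain ⟨y, rfl⟩ := hq w
    exact h4 (Submodule.mem_top (x := y))

/-! ### Exponent data -/

/-- Unit exponent. -/
def eUnit {N : ℕ} (i j : Fin (N + 1)) : Fin (N + 1) → Fin (N + 1) → ℕ :=
  fun a c => if a = i ∧ c = j then 1 else 0

/-- Additive weight of exponent data. -/
def wsum {N : ℕ} (w : Fin (N + 1) → Fin (N + 1) → ℕ) (n : Fin (N + 1) → Fin (N + 1) → ℕ) : ℕ :=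
  ∑ i, ∑ j, if i < j then w i j * n i j else 0

lemma wsum_add {N : ℕ} (w n m : Fin (N + 1) → Fin (N + 1) → ℕ) :
    wsum w (n + m) = wsum w n + wsum w m := by
  simp only [wsum, ← Finset.sum_add_distrib]
  refine Finset.sum_congr rfl fun i _ => Finset.sum_congr rfl fun j _ => ?_
  split_ifs
  · simp [mul_add]
  · rfl

lemma wsum_eUnit {N : ℕ} (w : Fin (N + 1) → Fin (N + 1) → ℕ) {i j : Fin (N + 1)} (h : i < j) :
    wsum w (eUnit i j) = w i j := by
  unfold wsum eUnit
  rw [Finset.sum_eq_single i, Finset.sum_eq_single j]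
  · simp [h]
  · intro c _ hc; simp [hc]
  · simp
  · intro a _ ha; simp [ha]
  · simp

lemma monB_add {N : ℕ} (n m : Fin (N + 1) → Fin (N + 1) → ℕ) :
    monB N (n + m) = monB N n * monB N m := by
  apply Subtype.ext
  simp only [monB, MulMemClass.mk_mul_mk, ← Finset.prod_mul_distrib]
  refine Finset.prod_congr rfl fun i _ => Finset.prod_congr rfl fun j _ => ?_
  split_ifs
  · simp [pow_add]
  · simp

lemma monB_zero {N : ℕ} : monB N 0 = 1 := by
  apply Subtype.ext
  simp [monB]

lemma monB_eUnit {N : ℕ} {i j : Fin (N + 1)} (h : i < j) :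
    (monB N (eUnit i j) : PR N) = Mang i j := by
  simp only [monB, eUnit]
  rw [Finset.prod_eq_single i, Finset.prod_eq_single j]
  · simp [h]
  · intro c _ hc; simp [hc]
  · simp
  · intro a _ ha; simp [ha]
  · simp

lemma plucker {N : ℕ} {i j k l : Fin (N + 1)} (h1 : i < j) (h2 : j < k) (h3 : k < l)
    (n : Fin (N + 1) → Fin (N + 1) → ℕ) :
    monB N (n + eUnit i k + eUnit j l) =
      monB N (n + eUnit i j + eUnit k l) + monB N (n + eUnit i l + eUnit j k) := by
  simp only [monB_add]
  apply Subtype.ext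
  push_cast
  rw [monB_eUnit (h1.trans h2), monB_eUnit (h2.trans h3), monB_eUnit h1, monB_eUnit h2,
    monB_eUnit h3, monB_eUnit (h1.trans (h2.trans h3))]
  simp only [Mang]
  ring

/-- Supported and noncrossing. -/
def SNC {N : ℕ} (n : Fin (N + 1) → Fin (N + 1) → ℕ) : Prop :=
  (∀ i j : Fin (N + 1), ¬ i < j → n i j = 0) ∧ NoCrossM n

lemma eq_add_of_ne {N : ℕ} {i j k l : Fin (N + 1)} (h1 : i < j)
    (n : Fin (N + 1) → Fin (N + 1) → ℕ) (ha : n i k ≠ 0) (hb : n j l ≠ 0) :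
    n = (fun a c => n a c - eUnit i k a c - eUnit j l a c) + eUnit i k + eUnit j l := by
  funext a c
  simp only [Pi.add_apply, eUnit]
  by_cases e1 : a = i ∧ c = k
  · have e2 : ¬ (a = j ∧ c = l) := by
      rintro ⟨e, _⟩; rw [e1.1] at e; exact h1.ne e
    rw [if_pos e1, if_neg e2, e1.1, e1.2]; omega
  · by_cases e2 : a = j ∧ c = l
    · rw [if_neg e1, if_pos e2, e2.1, e2.2]; omega
    · rw [if_neg e1, if_neg e2]; omega

/-- The concave potential. -/
def potF {N : ℕ} (i j : Fin (N + 1)) : ℕ := (j - i : ℕ) * (2 * N + 2 - (j - i : ℕ))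

/-- The endpoint weight. -/
def endW {N : ℕ} (i j : Fin (N + 1)) : ℕ :=
  (if N - 1 ≤ (i : ℕ) then 1 else 0) + (if N - 1 ≤ (j : ℕ) then 1 else 0)

lemma pot_aux (N a c d : ℕ) (ha : 0 < a) (hb : 0 < c) (hc : 0 < d) (h : a + c + d ≤ N) :
    a * (2 * N + 2 - a) + d * (2 * N + 2 - d) <
      (a + c) * (2 * N + 2 - (a + c)) + (c + d) * (2 * N + 2 - (c + d)) ∧
    (a + c + d) * (2 * N + 2 - (a + c + d)) + c * (2 * N + 2 - c) <
      (a + c) * (2 * N + 2 - (a + c)) + (c + d) * (2 * N + 2 - (c + d)) := by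
  obtain ⟨r, rfl⟩ := Nat.exists_eq_add_of_le h
  obtain ⟨a, rfl⟩ := Nat.exists_eq_succ_of_ne_zero ha.ne'
  obtain ⟨c, rfl⟩ := Nat.exists_eq_succ_of_ne_zero hb.ne'
  obtain ⟨d, rfl⟩ := Nat.exists_eq_succ_of_ne_zero hc.ne'
  zify [show a.succ ≤ 2 * (a.succ + c.succ + d.succ + r) + 2 by omega,
    show c.succ ≤ 2 * (a.succ + c.succ + d.succ + r) + 2 by omega,
    show d.succ ≤ 2 * (a.succ + c.succ + d.succ + r) + 2 by omega,
    show a.succ + c.succ ≤ 2 * (a.succ + c.succ + d.succ + r) + 2 by omega,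
    show c.succ + d.succ ≤ 2 * (a.succ + c.succ + d.succ + r) + 2 by omega,
    show a.succ + c.succ + d.succ ≤ 2 * (a.succ + c.succ + d.succ + r) + 2 by omega]
  push_cast
  constructor
  · rw [← sub_pos]; ring_nf; positivity
  · rw [← sub_pos]; ring_nf; positivity

lemma pot_lt {N : ℕ} {i j k l : Fin (N + 1)} (h1 : i < j) (h2 : j < k) (h3 : k < l) :
    potF i j + potF k l < potF i k + potF j l ∧ potF i l + potF j k < potF i k + potF j l := by
  have h1' : (i : ℕ) < j := h1
  have h2' : (j : ℕ) < k := h2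
  have h3' : (k : ℕ) < l := h3
  have hl := l.2
  have := pot_aux N (j - i : ℕ) (k - j : ℕ) (l - k : ℕ) (by omega) (by omega) (by omega) (by omega)
  unfold potF
  rw [show (j - i : ℕ) + (k - j : ℕ) = (k - i : ℕ) by omega,
    show (k - j : ℕ) + (l - k : ℕ) = (l - j : ℕ) by omega,
    show (k - i : ℕ) + (l - k : ℕ) = (l - i : ℕ) by omega] at this
  exact this

lemma straighten {N : ℕ} : ∀ (P : ℕ) (n : Fin (N + 1) → Fin (N + 1) → ℕ), wsum potF n = P →
    monB N n ∈ Submodule.span ℂ (monB N '' {m | SNC m ∧ wsum endW m ≤ wsum endW n}) := by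
  intro P
  induction P using Nat.strong_induction_on with
  | _ P ih =>
    intro n hn
    by_cases hc : NoCrossM n
    · apply Submodule.subset_span
      refine ⟨fun a c => if a < c then n a c else 0, ⟨⟨?_, ?_⟩, ?_⟩, ?_⟩
      · intro i j h; simp [h]
      · rintro p q ⟨i, j, h, h', rfl⟩ ⟨k, l, h2, h2', rfl⟩
        refine hc _ _ ⟨i, j, h, ?_, rfl⟩ ⟨k, l, h2, ?_, rfl⟩
        · simpa [h] using h'
        · simpa [h2] using h2'
      · apply le_of_eq
        unfold wsum
        refine Finset.sum_congr rfl fun i _ => Finset.sum_congr rfl fun j _ => ?_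
        split_ifs with h <;> simp [h]
      · apply Subtype.ext
        simp only [monB]
        refine Finset.prod_congr rfl fun i _ => Finset.prod_congr rfl fun j _ => ?_
        split_ifs <;> rfl
    · unfold NoCrossM at hc
      push Not at hc
      obtain ⟨p, q, ⟨i, k, hik, hn1, rfl⟩, ⟨j, l, hjl, hn2, rfl⟩, h1, h2, h3⟩ := hc
      have h1 : i < j := h1
      have h2 : j < k := h2
      have h3 : k < l := h3
      have h13 : i < l := h1.trans (h2.trans h3)
      have he := eq_add_of_ne h1 n hn1 hn2
      generalize (fun a c => n a c - eUnit i k a c - eUnit j l a c) = n0 at he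
      subst he
      rw [plucker h1 h2 h3]
      have hp := pot_lt h1 h2 h3
      simp only [wsum_add, wsum_eUnit _ hik, wsum_eUnit _ hjl] at hn
      apply Submodule.add_mem
      · have := ih _ (by rw [← hn]; simp only [wsum_add, wsum_eUnit _ h1, wsum_eUnit _ h3]; omega)
          (n0 + eUnit i j + eUnit k l) rfl
        have hw : wsum endW (n0 + eUnit i j + eUnit k l)
            = wsum endW (n0 + eUnit i k + eUnit j l) := by
          simp only [wsum_add, wsum_eUnit _ h1, wsum_eUnit _ h3, wsum_eUnit _ hik,
            wsum_eUnit _ hjl, endW]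
          omega
        rwa [hw] at this
      · have := ih _ (by rw [← hn]; simp only [wsum_add, wsum_eUnit _ h13, wsum_eUnit _ h2]; omega)
          (n0 + eUnit i l + eUnit j k) rfl
        have hw : wsum endW (n0 + eUnit i l + eUnit j k)
            = wsum endW (n0 + eUnit i k + eUnit j l) := by
          simp only [wsum_add, wsum_eUnit _ h13, wsum_eUnit _ h2, wsum_eUnit _ hik,
            wsum_eUnit _ hjl, endW]
          omega
        rwa [hw] at this

lemma span_monB (N : ℕ) (x : Balg N) : x ∈ Submodule.span ℂ (Set.range (monB N)) := by
  obtain ⟨x, hx⟩ := x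
  unfold Balg at hx
  refine Algebra.adjoin_induction
    (p := fun x hx => (⟨x, hx⟩ : Balg N) ∈ Submodule.span ℂ (Set.range (monB N))) ?_ ?_ ?_ ?_ hx
  · rintro _ ⟨i, j, h, rfl⟩
    apply Submodule.subset_span
    exact ⟨eUnit i j, Subtype.ext (monB_eUnit h)⟩
  · intro r
    have := Submodule.smul_mem (Submodule.span ℂ (Set.range (monB N))) r
      (Submodule.subset_span ⟨0, monB_zero⟩)
    convert this using 1
    apply Subtype.ext
    simp [Algebra.smul_def]
  · intro x y hx hy h1 h2
    exact Submodule.add_mem _ h1 h2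
  · intro x y hx hy h1 h2
    have h3 := Submodule.mul_mem_mul h1 h2
    rw [Submodule.span_mul_span] at h3
    refine Submodule.span_mono ?_ h3
    rintro _ ⟨_, ⟨n, rfl⟩, _, ⟨m, rfl⟩, rfl⟩
    exact ⟨n + m, monB_add n m⟩

/-! ### Linear independence of noncrossing monomials -/

lemma snc_inj {N : ℕ} {n m : Fin (N + 1) → Fin (N + 1) → ℕ} (hn : SNC n) (hm : SNC m)
    (hr : ∀ i, ∑ j, n i j = ∑ j, m i j) (hc : ∀ j, ∑ i, n i j = ∑ i, m i j) : n = m := by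
  by_contra hne
  let S : Finset (Fin (N + 1) × Fin (N + 1)) := Finset.univ.filter fun p => n p.1 p.2 ≠ m p.1 p.2
  have hS : S.Nonempty := by
    by_contra h
    rw [Finset.not_nonempty_iff_eq_empty] at h
    apply hne
    funext i j
    by_contra h'
    have : (i, j) ∈ S := by simp [S, h']
    rw [h] at this
    simp at this
  obtain ⟨⟨i, j⟩, hij, hmin⟩ := Finset.exists_min_image S (fun p => (p.2 : ℕ) - (p.1 : ℕ)) hS
  have key : ∀ n m : Fin (N + 1) → Fin (N + 1) → ℕ, SNC n → SNC m →
      (∀ i, ∑ j, n i j = ∑ j, m i j) → (∀ j, ∑ i, n i j = ∑ i, m i j) → m i j < n i j →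
      (∀ a c, n a c ≠ m a c → (j : ℕ) - (i : ℕ) ≤ (c : ℕ) - (a : ℕ)) → False := by
    intro n m hn hm hr hc hlt hmin
    have hijl : i < j := by
      by_contra h
      rw [hn.1 i j h] at hlt
      omega
    have hijl' : (i : ℕ) < j := hijl
    obtain ⟨k, hk⟩ : ∃ k, n i k < m i k := by
      by_contra h
      push Not at h
      have := Finset.sum_lt_sum (fun k _ => h k) ⟨j, Finset.mem_univ _, hlt⟩
      rw [hr i] at this
      omega
    obtain ⟨l, hl⟩ : ∃ l, n l j < m l j := by
      by_contra h
      push Not at h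
      have := Finset.sum_lt_sum (fun k _ => h k) ⟨i, Finset.mem_univ _, hlt⟩
      rw [hc j] at this
      omega
    have hik : i < k := by
      by_contra h
      rw [hm.1 i k h] at hk
      omega
    have hlj : l < j := by
      by_contra h
      rw [hm.1 l j h] at hl
      omega
    have hik' : (i : ℕ) < k := hik
    have hlj' : (l : ℕ) < j := hlj
    have a1 := hmin i k hk.ne
    have a2 := hmin l j hl.ne
    have b1 : (k : ℕ) ≠ j := by
      intro h
      have := Fin.ext h
      subst this
      omega
    have b2 : (l : ℕ) ≠ i := by
      intro h
      have := Fin.ext h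
      subst this
      omega
    refine hm.2 (l, j) (i, k) ⟨l, j, hlj, by omega, rfl⟩ ⟨i, k, hik, by omega, rfl⟩ ⟨?_, ?_, ?_⟩
    · show (l : ℕ) < i
      omega
    · exact hijl'
    · show (j : ℕ) < k
      omega
  have hmin' : ∀ a c, n a c ≠ m a c → (j : ℕ) - (i : ℕ) ≤ (c : ℕ) - (a : ℕ) := by
    intro a c h
    exact hmin (a, c) (by simp [S, h])
  have hij' : n i j ≠ m i j := by simpa [S] using hij
  rcases lt_or_gt_of_ne hij' with h | h
  · exact key m n hm hn (fun i => (hr i).symm) (fun i => (hc i).symm) h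
      (fun a c h => hmin' a c h.symm)
  · exact key n m hn hm hr hc h hmin'

lemma linInd_of_degree {σ ι : Type*} (o : MonomialOrder σ) (f : ι → MvPolynomial σ ℂ)
    (h0 : ∀ i, f i ≠ 0) (hinj : Function.Injective fun i => o.degree (f i)) :
    LinearIndependent ℂ f := by
  rw [linearIndependent_iff]
  intro l hl
  by_contra hne
  obtain ⟨k, hk1, hk2⟩ := Finset.exists_max_image l.support (fun i => o.toSyn (o.degree (f i)))
    (Finsupp.support_nonempty_iff.2 hne)
  have h1 := congrArg (coeff (o.degree (f k))) hl
  rw [Finsupp.linearCombination_apply, Finsupp.sum, coeff_sum, Finset.sum_eq_single k] at h1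
  · rw [coeff_smul, coeff_zero, smul_eq_mul, mul_eq_zero] at h1
    rcases h1 with h1 | h1
    · exact Finsupp.mem_support_iff.1 hk1 h1
    · exact h0 k (o.coeff_degree_eq_zero_iff.1 h1)
  · intro i hi hik
    rw [coeff_smul, o.coeff_eq_zero_of_lt, smul_zero]
    refine lt_of_le_of_ne (hk2 i hi) fun h => hik (hinj (o.toSyn.injective h))
  · intro h; exact absurd hk1 h

/-- The variables in lexicographic order. -/
abbrev LV (N : ℕ) := Lex (Fin (N + 1) ⊕ Fin (N + 1))

/-- The lexicographic monomial order. -/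
abbrev lexO (N : ℕ) : MonomialOrder (LV N) := MonomialOrder.lex

/-- Renaming to the ordered variables. -/
def ren (N : ℕ) : PR N →ₐ[ℂ] MvPolynomial (LV N) ℂ := rename toLex

lemma deg_Mang {N : ℕ} {i j : Fin (N + 1)} (h : i < j) :
    (lexO N).degree (ren N (Mang i j)) =
      Finsupp.single (toLex (Sum.inl i)) 1 + Finsupp.single (toLex (Sum.inr j)) 1 := by
  have hd : ∀ a c : LV N, (lexO N).degree (X a * X c : MvPolynomial (LV N) ℂ)
      = Finsupp.single a 1 + Finsupp.single c 1 := by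
    intro a c
    rw [MonomialOrder.degree_mul (X_ne_zero _) (X_ne_zero _), MonomialOrder.degree_X,
      MonomialOrder.degree_X]
  simp only [ren, Mang, map_sub, map_mul, rename_X]
  rw [MonomialOrder.degree_sub_of_lt, hd]
  rw [hd, hd, MonomialOrder.lex_lt_iff, Finsupp.Lex.lt_iff]
  refine ⟨toLex (Sum.inl i), ?_, ?_⟩
  · intro d hdl
    have e1 : toLex (Sum.inl i) ≠ d := hdl.ne'
    have e2 : toLex (Sum.inl j) ≠ d := by
      rintro rfl
      exact absurd (Sum.Lex.inl_lt_inl_iff.1 hdl) (not_lt.2 h.le)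
    have e3 : ∀ a, toLex (Sum.inr a) ≠ d := by
      rintro a rfl
      exact Sum.Lex.not_inr_lt_inl hdl
    simp [Finsupp.single_apply, e1, e2, e3]
  · have e2 : toLex (Sum.inl j) ≠ (toLex (Sum.inl i) : LV N) := by
      simp [h.ne']
    simp [Finsupp.single_apply, h.ne']

lemma ren_Mang_ne {N : ℕ} {i j : Fin (N + 1)} (h : i < j) : ren N (Mang i j) ≠ 0 := by
  apply (lexO N).ne_zero_of_degree_ne_zero
  rw [deg_Mang h]
  intro h'
  have := DFunLike.congr_fun h' (toLex (Sum.inl i))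
  simp at this

lemma ren_mon {N : ℕ} (n : Fin (N + 1) → Fin (N + 1) → ℕ) :
    ren N (monB N n : PR N) = ∏ i, ∏ j, if i < j then ren N (Mang i j) ^ n i j else 1 := by
  simp only [monB, map_prod]
  refine Finset.prod_congr rfl fun i _ => Finset.prod_congr rfl fun j _ => ?_
  split_ifs <;> simp

lemma fac_ne {N : ℕ} (n : Fin (N + 1) → Fin (N + 1) → ℕ) (i j : Fin (N + 1)) :
    (if i < j then ren N (Mang i j) ^ n i j else 1) ≠ 0 := by
  split_ifs with h
  · exact pow_ne_zero _ (ren_Mang_ne h)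
  · exact one_ne_zero

lemma ren_mon_ne {N : ℕ} (n : Fin (N + 1) → Fin (N + 1) → ℕ) : ren N (monB N n : PR N) ≠ 0 := by
  rw [ren_mon]
  exact Finset.prod_ne_zero_iff.2 fun i _ => Finset.prod_ne_zero_iff.2 fun j _ => fac_ne n i j

lemma deg_mon {N : ℕ} (n : Fin (N + 1) → Fin (N + 1) → ℕ) (hn : SNC n) :
    (lexO N).degree (ren N (monB N n : PR N)) = ∑ i, ∑ j, n i j •
      (Finsupp.single (toLex (Sum.inl i)) 1 + Finsupp.single (toLex (Sum.inr j)) 1) := by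
  rw [ren_mon, MonomialOrder.degree_prod
    (fun i _ => Finset.prod_ne_zero_iff.2 fun j _ => fac_ne n i j)]
  refine Finset.sum_congr rfl fun i _ => ?_
  rw [MonomialOrder.degree_prod (fun j _ => fac_ne n i j)]
  refine Finset.sum_congr rfl fun j _ => ?_
  split_ifs with h
  · rw [MonomialOrder.degree_pow, deg_Mang h]
  · rw [hn.1 i j h]; simp

lemma linInd_snc (N : ℕ) :
    LinearIndependent ℂ (fun m : { n : Fin (N + 1) → Fin (N + 1) → ℕ // SNC n } => monB N m.1) := by
  apply LinearIndependent.of_comp ((ren N).toLinearMap ∘ₗ (Balg N).val.toLinearMap)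
  apply linInd_of_degree (lexO N)
  · intro i
    exact ren_mon_ne _
  · rintro ⟨n, hn⟩ ⟨m, hm⟩ h
    have h' : (lexO N).degree (ren N (monB N n : PR N)) =
      (lexO N).degree (ren N (monB N m : PR N)) := h
    rw [deg_mon n hn, deg_mon m hm] at h'
    apply Subtype.ext
    apply snc_inj hn hm
    · intro i
      have := DFunLike.congr_fun h' (toLex (Sum.inl i))
      simpa [Finsupp.finsetSum_apply, Finsupp.single_apply, Finset.sum_ite_eq,
        ← Finset.sum_mul, ← Finset.mul_sum] using this
    · intro i
      have := DFunLike.congr_fun h' (toLex (Sum.inr i))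
      simpa [Finsupp.finsetSum_apply, Finsupp.single_apply] using this

lemma straighten' {N : ℕ} (n : Fin (N + 1) → Fin (N + 1) → ℕ) :
    monB N n ∈ Submodule.span ℂ (monB N '' {m | SNC m ∧ wsum endW m ≤ wsum endW n}) :=
  straighten _ n rfl

/-- The basis of noncrossing monomials. -/
def sncBasis (N : ℕ) :
    Module.Basis { n : Fin (N + 1) → Fin (N + 1) → ℕ // SNC n } ℂ (Balg N) :=
  Module.Basis.mk (linInd_snc N) (by
    intro x _
    have h : Submodule.span ℂ (Set.range (monB N)) ≤ Submodule.span ℂ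
        (Set.range fun m : { n : Fin (N + 1) → Fin (N + 1) → ℕ // SNC n } => monB N m.1) := by
      rw [Submodule.span_le]
      rintro _ ⟨n, rfl⟩
      refine Submodule.span_mono ?_ (straighten' n)
      rintro _ ⟨m, hm, rfl⟩
      exact ⟨⟨m, hm.1⟩, rfl⟩
    exact h (span_monB N x))

lemma sncBasis_apply (N : ℕ) (m : { n : Fin (N + 1) → Fin (N + 1) → ℕ // SNC n }) :
    sncBasis N m = monB N m.1 := by
  simp [sncBasis]

/-- The next-to-last index. -/
def uIdx (K : ℕ) : Fin (K + 1 + 1) := ⟨K, by omega⟩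

/-- The last index. -/
def vIdx (K : ℕ) : Fin (K + 1 + 1) := ⟨K + 1, by omega⟩

lemma uv_lt (K : ℕ) : uIdx K < vIdx K := by
  show K < K + 1
  omega

lemma snc_shift {K : ℕ} {n : Fin (K + 1 + 1) → Fin (K + 1 + 1) → ℕ} (hn : SNC n) :
    SNC (n + eUnit (uIdx K) (vIdx K) + eUnit (uIdx K) (vIdx K)) := by
  have harc : ∀ i j, (n + eUnit (uIdx K) (vIdx K) + eUnit (uIdx K) (vIdx K)) i j ≠ 0 →
      n i j ≠ 0 ∨ (i = uIdx K ∧ j = vIdx K) := by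
    intro i j h
    by_cases e : i = uIdx K ∧ j = vIdx K
    · exact Or.inr e
    · left
      simpa [eUnit, e] using h
  constructor
  · intro i j h
    by_contra h'
    rcases harc i j h' with h1 | ⟨rfl, rfl⟩
    · exact h1 (hn.1 i j h)
    · exact h (uv_lt K)
  · rintro p q ⟨i, j, h, h', rfl⟩ ⟨k, l, h2, h2', rfl⟩ ⟨a1, a2, a3⟩
    simp only at a1 a2 a3
    have hj := j.2
    have hl := l.2
    rcases harc i j h' with h1 | ⟨rfl, rfl⟩
    · rcases harc k l h2' with h3 | ⟨rfl, rfl⟩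
      · exact hn.2 _ _ ⟨i, j, h, h1, rfl⟩ ⟨k, l, h2, h3, rfl⟩ ⟨a1, a2, a3⟩
      · simp only [uIdx, vIdx] at a1 a2 a3
        omega
    · simp only [uIdx, vIdx] at a1 a2 a3
      omega

/-- Multiplication by the square of the arc of the last two indices. -/
def tauS (K : ℕ) (n : { n : Fin (K + 1 + 1) → Fin (K + 1 + 1) → ℕ // SNC n }) :
    { n : Fin (K + 1 + 1) → Fin (K + 1 + 1) → ℕ // SNC n } :=
  ⟨_, snc_shift n.2⟩

lemma msq_eq (N : ℕ) : (⟨Msq N, Msq_mem N⟩ : Balg N) =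
    ∑ i, ∑ j, if i < j then monB N (eUnit i j + eUnit i j) else 0 := by
  apply Subtype.ext
  simp only [Msq, AddSubmonoidClass.coe_finsetSum]
  refine Finset.sum_congr rfl fun i _ => Finset.sum_congr rfl fun j _ => ?_
  split_ifs with h
  · rw [monB_add]
    show _ = (monB N (eUnit i j) : PR N) * (monB N (eUnit i j) : PR N)
    rw [monB_eUnit h, sq]
  · rfl

lemma msq_mul {K : ℕ} (n : Fin (K + 1 + 1) → Fin (K + 1 + 1) → ℕ) :
    (⟨Msq (K + 1), Msq_mem (K + 1)⟩ : Balg (K + 1)) * monB (K + 1) n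
      - monB (K + 1) (n + eUnit (uIdx K) (vIdx K) + eUnit (uIdx K) (vIdx K)) ∈
    Submodule.span ℂ (monB (K + 1) '' {m | SNC m ∧ wsum endW m < wsum endW
      (n + eUnit (uIdx K) (vIdx K) + eUnit (uIdx K) (vIdx K))}) := by
  set R := monB (K + 1) (n + eUnit (uIdx K) (vIdx K) + eUnit (uIdx K) (vIdx K)) with hR
  have e1 : R = ∑ i, ∑ j, if i = uIdx K ∧ j = vIdx K then R else 0 := by
    rw [Finset.sum_eq_single (uIdx K), Finset.sum_eq_single (vIdx K)]
    · simp
    · intro c _ hc; simp [hc]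
    · simp
    · intro a _ ha; simp [ha]
    · simp
  rw [msq_eq, Finset.sum_mul]
  nth_rewrite 1 [e1]
  rw [← Finset.sum_sub_distrib]
  refine Submodule.sum_mem _ fun i _ => ?_
  rw [Finset.sum_mul, ← Finset.sum_sub_distrib]
  refine Submodule.sum_mem _ fun j _ => ?_
  by_cases huv : i = uIdx K ∧ j = vIdx K
  · obtain ⟨rfl, rfl⟩ := huv
    rw [if_pos (uv_lt K), if_pos ⟨rfl, rfl⟩, ← monB_add]
    have : eUnit (uIdx K) (vIdx K) + eUnit (uIdx K) (vIdx K) + n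
        = n + eUnit (uIdx K) (vIdx K) + eUnit (uIdx K) (vIdx K) := by
      abel
    rw [this, ← hR, sub_self]
    exact Submodule.zero_mem _
  · rw [if_neg huv, sub_zero]
    by_cases h : i < j
    · rw [if_pos h, ← monB_add]
      refine Submodule.span_mono ?_ (straighten' _)
      apply Set.image_mono
      rintro m ⟨hm1, hm2⟩
      refine ⟨hm1, lt_of_le_of_lt hm2 ?_⟩
      simp only [wsum_add, wsum_eUnit _ h, wsum_eUnit _ (uv_lt K)]
      have hw : endW i j < endW (uIdx K) (vIdx K) := by
        have h' : (i : ℕ) < j := h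
        have hj := j.2
        have : (i : ℕ) < K := by
          by_contra hc
          apply huv
          constructor
          · apply Fin.ext; simp only [uIdx]; omega
          · apply Fin.ext; simp only [vIdx]; omega
        have hu : (uIdx K : ℕ) = K := rfl
        have hv : (vIdx K : ℕ) = K + 1 := rfl
        unfold endW
        rw [if_neg (by omega), if_pos (by omega : K + 1 - 1 ≤ (uIdx K : ℕ)),
          if_pos (by omega : K + 1 - 1 ≤ (vIdx K : ℕ))]
        split_ifs <;> omega
      omega
    · rw [if_neg h, zero_mul]
      exact Submodule.zero_mem _

lemma tau_range {K : ℕ} (n : { n : Fin (K + 1 + 1) → Fin (K + 1 + 1) → ℕ // SNC n }) :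
    n ∈ Set.range (tauS K) ↔ 2 ≤ n.1 (uIdx K) (vIdx K) := by
  constructor
  · rintro ⟨m, rfl⟩
    simp [tauS, eUnit]
  · intro h
    refine ⟨⟨fun a c => n.1 a c - eUnit (uIdx K) (vIdx K) a c - eUnit (uIdx K) (vIdx K) a c,
      ?_, ?_⟩, ?_⟩
    · intro i j hij
      simp [n.2.1 i j hij]
    · rintro p q ⟨i, j, h1, h1', rfl⟩ ⟨k, l, h2, h2', rfl⟩
      simp only at h1' h2'
      exact n.2.2 _ _ ⟨i, j, h1, by omega, rfl⟩ ⟨k, l, h2, by omega, rfl⟩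
    · apply Subtype.ext
      funext a c
      simp only [tauS, Pi.add_apply, eUnit]
      by_cases e : a = uIdx K ∧ c = vIdx K
      · obtain ⟨rfl, rfl⟩ := e
        simp
        omega
      · simp [e]

/-- Good exponents are noncrossing. -/
def goodIncl (N : ℕ) (m : { n : Fin (N + 1) → Fin (N + 1) → ℕ // GoodM N n }) :
    { n : Fin (N + 1) → Fin (N + 1) → ℕ // SNC n } :=
  ⟨m.1, m.2.1, m.2.2.1⟩

lemma goodIncl_inj (N : ℕ) : Function.Injective (goodIncl N) := by
  intro a c h
  have h' : (goodIncl N a).1 = (goodIncl N c).1 := by rw [h]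
  exact Subtype.ext h'

lemma mkA_eq_zero {A : Type*} [CommRing A] [Algebra ℂ A] (I : Ideal A) (x : A) :
    (Ideal.Quotient.mkₐ ℂ I).toLinearMap x = 0 ↔ x ∈ I :=
  Ideal.Quotient.eq_zero_iff_mem

lemma mem_Iid {N : ℕ} (x : Balg N) :
    x ∈ Iid N ↔ ∃ y, (⟨Msq N, Msq_mem N⟩ : Balg N) * y = x := by
  unfold Iid
  rw [Ideal.mem_span_singleton']
  simp only [mul_comm]

lemma case_succ (K : ℕ) :
    LinearIndependent ℂ
      (fun m : { n : Fin (K + 1 + 1) → Fin (K + 1 + 1) → ℕ // GoodM (K + 1) n } =>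
        (Ideal.Quotient.mkₐ ℂ (Iid (K + 1))).toLinearMap (sncBasis (K + 1) (goodIncl (K + 1) m)))
    ∧ Submodule.span ℂ
        (Set.range (fun m : { n : Fin (K + 1 + 1) → Fin (K + 1 + 1) → ℕ // GoodM (K + 1) n } =>
          (Ideal.Quotient.mkₐ ℂ (Iid (K + 1))).toLinearMap
            (sncBasis (K + 1) (goodIncl (K + 1) m)))) = ⊤ := by
  refine abs_quot (sncBasis (K + 1)) (fun m => wsum endW m.1) (tauS K) ?_ ?_
    (LinearMap.mulLeft ℂ (⟨Msq (K + 1), Msq_mem (K + 1)⟩ : Balg (K + 1))) ?_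
    (goodIncl (K + 1)) (goodIncl_inj _) ?_ _ ?_ ?_
  · intro a c h
    apply Subtype.ext
    have := congrArg Subtype.val h
    simpa [tauS] using this
  · intro a c h
    simp only [tauS, wsum_add]
    omega
  · intro i
    rw [sncBasis_apply, sncBasis_apply, LinearMap.mulLeft_apply]
    refine Submodule.span_mono ?_ (msq_mul i.1)
    rintro _ ⟨m, hm, rfl⟩
    exact ⟨⟨m, hm.1⟩, hm.2, sncBasis_apply _ _⟩
  · intro i
    rw [tau_range]
    constructor
    · rintro ⟨m, rfl⟩
      have := m.2.2.2 (uIdx K) (vIdx K) (by simp [uIdx]) (by simp [vIdx])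
      simp only [goodIncl]
      omega
    · intro h
      refine ⟨⟨i.1, i.2.1, i.2.2, ?_⟩, rfl⟩
      intro a c ha hc
      have e1 : a = uIdx K := Fin.ext (by simpa [uIdx] using ha)
      have e2 : c = vIdx K := Fin.ext (by simpa [vIdx] using hc)
      rw [e1, e2]
      omega
  · exact Ideal.Quotient.mk_surjective
  · ext x
    rw [LinearMap.mem_ker, LinearMap.mem_range]
    rw [mkA_eq_zero, mem_Iid]
    rfl

lemma case_zero :
    LinearIndependent ℂ
      (fun m : { n : Fin (0 + 1) → Fin (0 + 1) → ℕ // GoodM 0 n } =>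
        (Ideal.Quotient.mkₐ ℂ (Iid 0)).toLinearMap (sncBasis 0 (goodIncl 0 m)))
    ∧ Submodule.span ℂ
        (Set.range (fun m : { n : Fin (0 + 1) → Fin (0 + 1) → ℕ // GoodM 0 n } =>
          (Ideal.Quotient.mkₐ ℂ (Iid 0)).toLinearMap (sncBasis 0 (goodIncl 0 m)))) = ⊤ := by
  have hI : Iid 0 = ⊥ := by
    have : (⟨Msq 0, Msq_mem 0⟩ : Balg 0) = 0 := by
      apply Subtype.ext
      simp [Msq]
    rw [Iid, this]
    simp
  have hker : LinearMap.ker (Ideal.Quotient.mkₐ ℂ (Iid 0)).toLinearMap = ⊥ := by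
    rw [eq_bot_iff]
    intro x hx
    have hx' := (mkA_eq_zero (Iid 0) x).1 hx
    rw [hI] at hx'
    exact hx'
  constructor
  · exact ((sncBasis 0).linearIndependent.comp _ (goodIncl_inj 0)).map' _ hker
  · have hr : Set.range (fun m => sncBasis 0 (goodIncl 0 m)) = Set.range (sncBasis 0) := by
      apply Set.Subset.antisymm
      · rintro _ ⟨m, rfl⟩
        exact ⟨_, rfl⟩
      · rintro _ ⟨m, rfl⟩
        refine ⟨⟨m.1, m.2.1, m.2.2, ?_⟩, rfl⟩
        intro i j _ _
        rw [m.2.1 i j (by omega)]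
        omega
    rw [Set.range_comp' (Ideal.Quotient.mkₐ ℂ (Iid 0)).toLinearMap, hr, Submodule.span_image,
      (sncBasis 0).span_eq, Submodule.map_top, LinearMap.range_eq_top]
    exact Ideal.Quotient.mk_surjective

set_option synthInstance.maxHeartbeats 1000000 in
set_option maxHeartbeats 1000000 in
theorem statement15 (N : ℕ) :
    LinearIndependent ℂ
      (fun m : { n : Fin (N + 1) → Fin (N + 1) → ℕ // GoodM N n } =>
        Ideal.Quotient.mk (Iid N) (monB N m.1))
    ∧ Submodule.span ℂ
        (Set.range (fun m : { n : Fin (N + 1) → Fin (N + 1) → ℕ // GoodM N n } =>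
          Ideal.Quotient.mk (Iid N) (monB N m.1))) = ⊤ := by

  have h : ∀ m : { n : Fin (N + 1) → Fin (N + 1) → ℕ // GoodM N n },
      (Ideal.Quotient.mkₐ ℂ (Iid N)).toLinearMap (sncBasis N (goodIncl N m))
        = Ideal.Quotient.mk (Iid N) (monB N m.1) := by
    intro m
    rw [sncBasis_apply]
    rfl
  simp only [← h]
  cases N with
  | zero => exact case_zero
  | succ K => exact case_succ K
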